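/- arXiv:1509.04935 — 2 statements merged into one kernel-verified Lean document; each statement's English description precedes it below -/
import Mathlib

section
/- Let n ≥ 1 and d ≥ 2 be integers, set N := C(n+d, d) − 1, and let m be an integer with n ≤ m ≤ N − 1. Set M := n + (N−m)(m−n), ε := ((m−n)^{N−m}) and ε' := ((N−m)^{m−n}). Then ∑_λ f^λ · f^{λ+ε} · ∏_{i=1}^{N−m} (n+i)!/(n+i−λ_i)! = n! · ∑_{k=0}^{n} [(−1)^{n−k} (n+1)^k / (n−k)!] · C(M, k) · ∑_{λ'} f^{λ'} · f^{λ'+ε'} · ∏_{i=1}^{m−n} (n+i)!/(n+i−λ'_i)!, where the sum on the left runs over all partitions λ = (λ_1, …, λ_{N−m}) of n with at most N − m parts (f^λ, f^{λ+ε} computed with length N − m), and the inner sums on the right run over all partitions λ' = (λ'_1, …, λ'_{m−n}) of n − k with at most m − n parts (f^{λ'}, f^{λ'+ε'} computed with length m − n; for m = n the inner sum is empty unless k = n, in which case it equals 1). -/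
open Finset

/-- `fSYT e lam` is the rational number
`|λ|! · ∏_{1 ≤ i < j ≤ e} (λ_i − λ_j + j − i) / ∏_{1 ≤ i ≤ e} (λ_i + e − i)!`,
for a tuple `λ = (λ_1, …, λ_e)` encoded as `lam : Fin e → ℕ` (0-indexed).
By the hook length formula this is the number of standard Young tableaux
of shape `λ` when `λ` is weakly decreasing. -/
def fSYT (e : ℕ) (lam : Fin e → ℕ) : ℚ :=
  ((∑ i, lam i).factorial : ℚ) *
    (∏ i : Fin e, ∏ j ∈ Finset.Ioi i,
      ((lam i : ℚ) - (lam j : ℚ) + ((j : ℕ) : ℚ) - ((i : ℕ) : ℚ))) /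
  ∏ i : Fin e, ((lam i + e - 1 - (i : ℕ)).factorial : ℚ)

/-- The finset of partitions of `n` with at most `e` parts, encoded as weakly
decreasing functions `Fin e → ℕ` (padded with trailing zeros) summing to `n`. -/
def partitionsOf (e n : ℕ) : Finset (Fin e → ℕ) :=
  (Fintype.piFinset fun _ : Fin e => Finset.range (n + 1)).filter
    (fun lam => (∀ i j : Fin e, i ≤ j → lam j ≤ lam i) ∧ ∑ i, lam i = n)

/-- Jacobi's formula for a derivation `D` and a matrix solving `D E = Y E`. -/
theorem derivation_det_of_linear {ι S R : Type*} [Fintype ι] [DecidableEq ι] [CommRing S] [CommRing R]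
    [Algebra S R] (D : Derivation S R R) (E Y : Matrix ι ι R) (h : ∀ i j, D (E i j) = (Y * E) i j) :
    D E.det = Y.trace * E.det := by
  have hprod : ∀ (s : Finset ι) (f : ι → R),
      D (∏ i ∈ s, f i) = ∑ i ∈ s, (∏ j ∈ s.erase i, f j) * D (f i) := by
    intro s f
    induction s using Finset.induction_on with
    | empty => simp
    | insert a s ha ih =>
      rw [Finset.prod_insert ha, Derivation.leibniz, ih, Finset.sum_insert ha,
        Finset.erase_insert ha, add_comm, smul_eq_mul, smul_eq_mul, Finset.mul_sum]
      congr 1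
      refine Finset.sum_congr rfl fun i hi => ?_
      have hne : a ≠ i := fun h => ha (h ▸ hi)
      rw [Finset.erase_insert_of_ne hne, Finset.prod_insert (by simp [ha])]
      ring
  have hrow : ∀ i, (E.updateRow i (fun j => D (E i j))).det = Y i i * E.det := by
    intro i
    have : (fun j => D (E i j)) = ∑ k, Y i k • E k := by
      funext j
      simp [h, Matrix.mul_apply, Finset.sum_apply]
    rw [this, Matrix.det_updateRow_sum, smul_eq_mul]
  have hexp : D E.det = ∑ i, (E.updateRow i (fun j => D (E i j))).det := by
    simp_rw [← Matrix.det_transpose E, ← Matrix.det_transpose (Matrix.updateRow _ _ _),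
      Matrix.det_apply']
    rw [map_sum, Finset.sum_comm]
    refine Finset.sum_congr rfl fun σ _ => ?_
    rw [← zsmul_eq_mul, map_zsmul, hprod, zsmul_eq_mul, Finset.mul_sum]
    refine Finset.sum_congr rfl fun i _ => ?_
    rw [← Finset.mul_prod_erase _ _ (Finset.mem_univ i)]
    simp only [Matrix.transpose_apply, Matrix.updateRow_self]
    rw [mul_comm (D _)]
    congr 2
    refine Finset.prod_congr rfl fun j hj => ?_
    rw [Matrix.updateRow_ne (Finset.ne_of_mem_erase hj)]
  rw [hexp, Matrix.trace, Finset.sum_mul]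
  exact Finset.sum_congr rfl fun i _ => hrow i

/-- The formal exponential `exp (tY)` of a rational matrix. -/
def expMatrix {ι : Type*} [Fintype ι] [DecidableEq ι] (Y : Matrix ι ι ℚ) :
    Matrix ι ι (PowerSeries ℚ) :=
  Matrix.of fun i j => PowerSeries.mk fun l => (Y ^ l) i j / (l.factorial : ℚ)

theorem det_expMatrix {ι : Type*} [Fintype ι] [DecidableEq ι] (Y : Matrix ι ι ℚ) :
    (expMatrix Y).det = PowerSeries.rescale Y.trace (PowerSeries.exp ℚ) := by
  have hD := derivation_det_of_linear (PowerSeries.derivative ℚ)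
    (expMatrix Y) (Y.map PowerSeries.C) (by
      intro i j
      ext l
      simp only [PowerSeries.coeff_derivative, expMatrix,
        Matrix.of_apply, PowerSeries.coeff_mk, Matrix.mul_apply, Matrix.map_apply, map_sum,
        PowerSeries.coeff_C_mul, pow_succ' Y l, Finset.sum_div, Finset.sum_mul]
      refine Finset.sum_congr rfl fun k _ => ?_
      rw [Nat.factorial_succ]
      push_cast
      field_simp)
  have htr : (Y.map (PowerSeries.C (R := ℚ))).trace = PowerSeries.C Y.trace := by
    simp [Matrix.trace, map_sum]
  rw [htr] at hD
  have h0 : PowerSeries.coeff 0 (expMatrix Y).det = 1 := by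
    rw [PowerSeries.coeff_zero_eq_constantCoeff_apply, RingHom.map_det]
    have : (PowerSeries.constantCoeff (R := ℚ)).mapMatrix (expMatrix Y) = 1 := by
      ext i j
      rw [RingHom.mapMatrix_apply, Matrix.map_apply,
        ← PowerSeries.coeff_zero_eq_constantCoeff_apply]
      simp [expMatrix]
    rw [this, Matrix.det_one]
  ext l
  rw [PowerSeries.coeff_rescale, PowerSeries.coeff_exp]
  induction l with
  | zero => simp [h0]
  | succ l ih =>
    have := congrArg (PowerSeries.coeff l) hD
    rw [PowerSeries.coeff_derivative, PowerSeries.coeff_C_mul,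
      ih] at this
    rw [eq_div_of_mul_eq (by positivity) this, Nat.factorial_succ, pow_succ]
    simp only [eq_ratCast, Rat.cast_id]
    push_cast
    field_simp

theorem expMatrix_mul_neg {ι : Type*} [Fintype ι] [DecidableEq ι] (Y : Matrix ι ι ℚ) :
    expMatrix Y * (expMatrix Y).map (PowerSeries.rescale (-1 : ℚ)) = 1 := by
  ext i j l
  have hexp := congrArg (PowerSeries.coeff l) (PowerSeries.exp_mul_exp_neg_eq_one (A := ℚ))
  rw [PowerSeries.coeff_mul] at hexp
  have key : ∀ k, PowerSeries.coeff l
      (expMatrix Y i k * PowerSeries.rescale (-1 : ℚ) (expMatrix Y k j)) =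
      ∑ p ∈ antidiagonal l, PowerSeries.coeff p.1 (PowerSeries.exp ℚ) *
        PowerSeries.coeff p.2 (PowerSeries.evalNegHom (PowerSeries.exp ℚ)) *
          ((Y ^ p.1) i k * (Y ^ p.2) k j) := by
    intro k
    rw [PowerSeries.coeff_mul]
    refine Finset.sum_congr rfl fun p _ => ?_
    simp [expMatrix, PowerSeries.evalNegHom, PowerSeries.coeff_rescale, PowerSeries.coeff_exp]
    ring
  rw [Matrix.mul_apply, map_sum]
  simp only [Matrix.map_apply]
  rw [Finset.sum_congr rfl fun k _ => key k, Finset.sum_comm]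
  have : ∀ p ∈ antidiagonal l, ∑ k, PowerSeries.coeff p.1 (PowerSeries.exp ℚ) *
        PowerSeries.coeff p.2 (PowerSeries.evalNegHom (PowerSeries.exp ℚ)) *
          ((Y ^ p.1) i k * (Y ^ p.2) k j) = PowerSeries.coeff p.1 (PowerSeries.exp ℚ) *
        PowerSeries.coeff p.2 (PowerSeries.evalNegHom (PowerSeries.exp ℚ)) * (Y ^ l) i j := by
    intro p hp
    rw [← Finset.mul_sum, ← Matrix.mul_apply, ← pow_add, mem_antidiagonal.1 hp]
  rw [Finset.sum_congr rfl this, ← Finset.sum_mul, hexp, PowerSeries.coeff_one]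
  rcases eq_or_ne l 0 with rfl | hl
  · by_cases hij : i = j <;> simp [Matrix.one_apply, hij]
  · by_cases hij : i = j <;> simp [Matrix.one_apply, hij, hl, PowerSeries.coeff_one]

/-- Jacobi's complementary minor formula, in block form. -/
theorem det_toBlocks₁₁_eq_of_mul_eq_one {m n R : Type*} [Fintype m] [DecidableEq m] [Fintype n]
    [DecidableEq n] [CommRing R] (A B : Matrix (m ⊕ n) (m ⊕ n) R) (h : A * B = 1) :
    A.toBlocks₁₁.det = A.det * B.toBlocks₂₂.det := by
  have hAB : A * B = Matrix.fromBlocks A.toBlocks₁₁ A.toBlocks₁₂ A.toBlocks₂₁ A.toBlocks₂₂ *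
      Matrix.fromBlocks B.toBlocks₁₁ B.toBlocks₁₂ B.toBlocks₂₁ B.toBlocks₂₂ := by
    rw [Matrix.fromBlocks_toBlocks, Matrix.fromBlocks_toBlocks]
  rw [h, Matrix.fromBlocks_multiply, ← Matrix.fromBlocks_one, Matrix.fromBlocks_inj] at hAB
  obtain ⟨-, h12, -, h22⟩ := hAB
  have : A * Matrix.fromBlocks 1 B.toBlocks₁₂ 0 B.toBlocks₂₂ =
      Matrix.fromBlocks A.toBlocks₁₁ 0 A.toBlocks₂₁ 1 := by
    conv_lhs => rw [← Matrix.fromBlocks_toBlocks A]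
    rw [Matrix.fromBlocks_multiply]
    simp [← h12, ← h22]
  have hdet := congrArg Matrix.det this
  rw [Matrix.det_mul, Matrix.det_fromBlocks_zero₂₁, Matrix.det_fromBlocks_zero₁₂] at hdet
  simpa using hdet.symm

/-- The bijection placing the `e` columns of the first block after the `g` columns of the
second one. -/
def blockSwap (e g : ℕ) : Fin e ⊕ Fin g ≃ Fin (e + g) :=
  finSumFinEquiv.trans (finRotate (e + g) ^ g)

theorem coe_finRotate_pow (r k : ℕ) (j : Fin r) :
    (((finRotate r ^ k) j : Fin r) : ℕ) = (j + k) % r := by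
  obtain _ | r := r
  · exact j.elim0
  induction k with
  | zero => simp [Nat.mod_eq_of_lt j.isLt]
  | succ k ih =>
    rw [pow_succ', Equiv.Perm.mul_apply, finRotate_apply, Fin.val_add, ih, Fin.val_one', ← Nat.add_mod,
      add_assoc]

theorem blockSwap_inl (e g : ℕ) (k : Fin e) : (blockSwap e g (Sum.inl k) : ℕ) = k + g := by
  simp only [blockSwap, Equiv.trans_apply, coe_finRotate_pow, finSumFinEquiv_apply_left,
    Fin.val_castAdd]
  exact Nat.mod_eq_of_lt (by omega)

theorem blockSwap_inr (e g : ℕ) (k : Fin g) : (blockSwap e g (Sum.inr k) : ℕ) = k := by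
  simp only [blockSwap, Equiv.trans_apply, coe_finRotate_pow, finSumFinEquiv_apply_right,
    Fin.val_natAdd]
  rw [show e + (k : ℕ) + g = k + (e + g) by ring, Nat.add_mod_right]
  exact Nat.mod_eq_of_lt (by omega)

theorem det_submatrix_blockSwap {R : Type*} [CommRing R] (e g : ℕ)
    (A : Matrix (Fin (e + g)) (Fin (e + g)) R) :
    (A.submatrix finSumFinEquiv (blockSwap e g)).det = (-1) ^ (e * g) * A.det := by
  have h : A.submatrix finSumFinEquiv (blockSwap e g) =
      (A.submatrix id (finRotate (e + g) ^ g : Equiv.Perm _)).submatrix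
        finSumFinEquiv finSumFinEquiv := by
    ext i j; simp [blockSwap]
  rw [h, Matrix.det_submatrix_equiv_self, Matrix.det_permute', map_pow, sign_finRotate]
  congr 1
  push_cast
  rw [← pow_mul]
  obtain _ | g := g
  · simp
  rw [show (e + (g + 1) - 1) * (g + 1) = e * (g + 1) + g * (g + 1) by
    rw [← add_assoc, Nat.add_sub_cancel]; ring, pow_add, (Nat.even_mul_succ_self g).neg_one_pow,
    mul_one]

/-- The finite lower triangular Toeplitz matrix of a power series. -/
noncomputable def toeplitz (r : ℕ) (u : PowerSeries ℚ) : Matrix (Fin r) (Fin r) ℚ :=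
  Matrix.of fun i k => PowerSeries.coeff (i : ℕ) (PowerSeries.X ^ (k : ℕ) * u)

theorem toeplitz_of_lt {r : ℕ} (u : PowerSeries ℚ) {i k : Fin r} (h : i < k) :
    toeplitz r u i k = 0 := by
  rw [toeplitz, Matrix.of_apply, PowerSeries.coeff_X_pow_mul', if_neg (by simpa using h)]

theorem toeplitz_mul (r : ℕ) (u v : PowerSeries ℚ) :
    toeplitz r u * toeplitz r v = toeplitz r (u * v) := by
  ext i k
  rw [Matrix.mul_apply]
  simp only [toeplitz, Matrix.of_apply]
  rw [show PowerSeries.X ^ (k : ℕ) * (u * v) = (PowerSeries.X ^ (k : ℕ) * v) * u by ring,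
    PowerSeries.coeff_mul, Finset.Nat.sum_antidiagonal_eq_sum_range_succ
      (fun a b => PowerSeries.coeff a (PowerSeries.X ^ (k : ℕ) * v) * PowerSeries.coeff b u),
    Fin.sum_univ_eq_sum_range (fun j => PowerSeries.coeff (i : ℕ) (PowerSeries.X ^ j * u) *
      PowerSeries.coeff j (PowerSeries.X ^ (k : ℕ) * v))]
  symm
  refine Finset.sum_subset_zero_on_sdiff (by
    intro j hj; simp only [Finset.mem_range] at hj ⊢; omega) ?_ ?_
  · intro j hj
    simp only [Finset.mem_sdiff, Finset.mem_range] at hj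
    rw [PowerSeries.coeff_X_pow_mul', if_neg (by omega), zero_mul]
  · intro j hj
    rw [Finset.mem_range] at hj
    rw [PowerSeries.coeff_X_pow_mul' u, if_pos (by omega), mul_comm]

theorem toeplitz_one (r : ℕ) : toeplitz r 1 = 1 := by
  ext i k
  simp [toeplitz, PowerSeries.coeff_X_pow, Matrix.one_apply, Fin.ext_iff]

theorem det_toeplitz (r : ℕ) (u : PowerSeries ℚ) (hu : PowerSeries.coeff 0 u = 1) :
    (toeplitz r u).det = 1 := by
  rw [← Matrix.det_transpose, Matrix.det_of_isUpperTriangular]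
  · refine Finset.prod_eq_one fun i _ => ?_
    rw [Matrix.transpose_apply, toeplitz, Matrix.of_apply, PowerSeries.coeff_X_pow_mul',
      if_pos le_rfl, Nat.sub_self, hu]
  · intro i k h
    exact toeplitz_of_lt u h

/-- The matrix with entries `∑ l, h (l + j - k - g) t ^ l / l!`, where `h` are the coefficients
of `hs`. -/
noncomputable def expToeplitz (hs : PowerSeries ℚ) (e g : ℕ) : Matrix (Fin e) (Fin e) (PowerSeries ℚ) :=
  Matrix.of fun j k => PowerSeries.mk fun l =>
    PowerSeries.coeff (l + j) (PowerSeries.X ^ ((k : ℕ) + g) * hs) / (l.factorial : ℚ)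

/-- The companion matrix of the linear recurrence with coefficients those of `cs`. -/
noncomputable def recMatrix (r : ℕ) (cs : PowerSeries ℚ) : Matrix (Fin r) (Fin r) ℚ :=
  Matrix.of fun i j => if (i : ℕ) + 1 < r then (if (j : ℕ) = i + 1 then 1 else 0)
    else - PowerSeries.coeff (r - j) cs

theorem trace_recMatrix {r : ℕ} (hr : 0 < r) (cs : PowerSeries ℚ) :
    (recMatrix r cs).trace = - PowerSeries.coeff 1 cs := by
  obtain ⟨r, rfl⟩ := Nat.exists_eq_succ_of_ne_zero hr.ne'
  rw [Matrix.trace, Fin.sum_univ_castSucc, Finset.sum_eq_zero]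
  · simp [recMatrix]
  · intro i _
    simp [recMatrix]

theorem recMatrix_pow_mul_toeplitz (r : ℕ) (cs hs : PowerSeries ℚ)
    (h0 : PowerSeries.coeff 0 cs = 1) (hvan : ∀ i, r < i → PowerSeries.coeff i cs = 0)
    (hch : cs * hs = 1) (l : ℕ) (i k : Fin r) :
    (recMatrix r cs ^ l * toeplitz r hs) i k =
      PowerSeries.coeff (l + i) (PowerSeries.X ^ (k : ℕ) * hs) := by
  induction l generalizing i with
  | zero => simp [toeplitz]
  | succ l ih =>
    rw [pow_succ', Matrix.mul_assoc, Matrix.mul_apply]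
    simp only [ih]
    by_cases hi : (i : ℕ) + 1 < r
    · rw [Finset.sum_eq_single ⟨i + 1, hi⟩]
      · simp [recMatrix, hi, show l + 1 + (i : ℕ) = l + (i + 1) by ring]
      · intro b _ hb
        have : (b : ℕ) ≠ i + 1 := fun h => hb (Fin.ext h)
        simp [recMatrix, hi, this]
      · simp
    · have hir : l + 1 + (i : ℕ) = l + r := by omega
      have hrec : PowerSeries.coeff (l + r) (cs * (PowerSeries.X ^ (k : ℕ) * hs)) = 0 := by
        rw [mul_left_comm, hch, mul_one, PowerSeries.coeff_X_pow, if_neg (by omega)]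
      rw [PowerSeries.coeff_mul, Finset.Nat.sum_antidiagonal_eq_sum_range_succ
        (fun a b => PowerSeries.coeff a cs *
          PowerSeries.coeff b (PowerSeries.X ^ (k : ℕ) * hs)),
        ← Finset.sum_subset (s₁ := Finset.range (r + 1)) (by
          intro j hj; simp only [Finset.mem_range] at hj ⊢; omega) (by
          intro j _ hj
          rw [hvan j (by simpa [Nat.lt_succ_iff] using hj), zero_mul]),
        Finset.sum_range_succ', h0, one_mul, ← Finset.sum_range_reflect] at hrec
      rw [hir]
      simp only [recMatrix, Matrix.of_apply, hi, if_false]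
      rw [Fin.sum_univ_eq_sum_range (fun j => - PowerSeries.coeff (r - j) cs *
        PowerSeries.coeff (l + j) (PowerSeries.X ^ (k : ℕ) * hs))]
      simp only [neg_mul, Finset.sum_neg_distrib]
      rw [neg_eq_iff_add_eq_zero]
      rw [Nat.sub_zero] at hrec
      convert hrec using 2
      refine Finset.sum_congr rfl fun j hj => ?_
      rw [Finset.mem_range] at hj
      rw [show r - 1 - j + 1 = r - j by omega, show l + r - (r - j) = l + j by omega]

theorem expMatrix_mul_toeplitz (r : ℕ) (cs hs : PowerSeries ℚ)
    (h0 : PowerSeries.coeff 0 cs = 1) (hvan : ∀ i, r < i → PowerSeries.coeff i cs = 0)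
    (hch : cs * hs = 1) (i k : Fin r) :
    (expMatrix (recMatrix r cs) * (toeplitz r hs).map PowerSeries.C) i k =
      PowerSeries.mk fun l =>
        PowerSeries.coeff (l + i) (PowerSeries.X ^ (k : ℕ) * hs) / (l.factorial : ℚ) := by
  ext l
  rw [PowerSeries.coeff_mk, ← recMatrix_pow_mul_toeplitz r cs hs h0 hvan hch,
    Matrix.mul_apply, Matrix.mul_apply, map_sum, Finset.sum_div]
  refine Finset.sum_congr rfl fun j _ => ?_
  simp only [expMatrix, Matrix.of_apply, Matrix.map_apply, PowerSeries.coeff_mul_C,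
    PowerSeries.coeff_mk]
  ring

theorem det_expToeplitz_duality (cs hs : PowerSeries ℚ) (e g : ℕ) (hr : 0 < e + g)
    (h0 : PowerSeries.coeff 0 cs = 1) (hvan : ∀ i, e + g < i → PowerSeries.coeff i cs = 0)
    (hch : cs * hs = 1) :
    (expToeplitz hs e g).det = (-1) ^ (e * g) *
      PowerSeries.rescale (- PowerSeries.coeff 1 cs) (PowerSeries.exp ℚ) *
      PowerSeries.rescale (-1) (expToeplitz hs g e).det := by
  have hh0 : PowerSeries.coeff 0 hs = 1 := by
    have := congrArg (PowerSeries.coeff 0) hch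
    rw [PowerSeries.coeff_mul, Finset.Nat.antidiagonal_zero, Finset.sum_singleton, h0,
      one_mul] at this
    simpa using this
  set E := expMatrix (recMatrix (e + g) cs) with hE
  set E' := E.map (PowerSeries.rescale (-1 : ℚ)) with hE'
  set T := (toeplitz (e + g) hs).map (PowerSeries.C (R := ℚ)) with hT
  set L := (toeplitz (e + g) cs).map (PowerSeries.C (R := ℚ)) with hL
  have hTL : T * L = 1 := by
    rw [hT, hL, ← Matrix.map_mul, toeplitz_mul, mul_comm, hch, toeplitz_one,
      Matrix.map_one _ (map_zero _) (map_one _)]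
  have hEE : E * E' = 1 := expMatrix_mul_neg _
  have hAB : (E * T) * (L * (E' * T) * L) = 1 := by
    calc (E * T) * (L * (E' * T) * L) = E * (T * L) * E' * (T * L) := by
          simp only [Matrix.mul_assoc]
      _ = 1 := by rw [hTL, Matrix.mul_one, Matrix.mul_one, hEE]
  have hdetT : T.det = 1 := by
    rw [hT, ← RingHom.mapMatrix_apply, ← RingHom.map_det, det_toeplitz _ _ hh0, map_one]
  have hdetA : (E * T).det =
      PowerSeries.rescale (- PowerSeries.coeff 1 cs) (PowerSeries.exp ℚ) := by
    rw [Matrix.det_mul, hdetT, mul_one, hE, det_expMatrix, trace_recMatrix hr]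
  have hET : ∀ i k, (E' * T) i k = PowerSeries.rescale (-1) ((E * T) i k) := by
    intro i k
    rw [Matrix.mul_apply, Matrix.mul_apply, map_sum]
    refine Finset.sum_congr rfl fun j _ => ?_
    rw [map_mul, hE', hT]
    congr 1
    ext l
    simp only [Matrix.map_apply, PowerSeries.coeff_rescale, PowerSeries.coeff_C]
    split_ifs with hl <;> simp [hl]
  let ρ : Fin e ⊕ Fin g ≃ Fin (e + g) := finSumFinEquiv
  let κ : Fin e ⊕ Fin g ≃ Fin (e + g) := blockSwap e g
  have hsub : ((E * T).submatrix ρ κ) * ((L * (E' * T) * L).submatrix κ ρ) = 1 := by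
    rw [Matrix.submatrix_mul_equiv, hAB, Matrix.submatrix_one_equiv]
  have hcomp := det_toBlocks₁₁_eq_of_mul_eq_one _ _ hsub
  rw [det_submatrix_blockSwap, hdetA] at hcomp
  have h11 : ((E * T).submatrix ρ κ).toBlocks₁₁ = expToeplitz hs e g := by
    ext1 i k
    rw [Matrix.toBlocks₁₁, Matrix.of_apply, Matrix.submatrix_apply, hE, hT,
      expMatrix_mul_toeplitz _ _ _ h0 hvan hch, expToeplitz, Matrix.of_apply, blockSwap_inl]
    simp [ρ]
  have h22 : ((E' * T).submatrix κ ρ).toBlocks₂₂ =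
      (expToeplitz hs g e).map (PowerSeries.rescale (-1)) := by
    ext1 i k
    rw [Matrix.toBlocks₂₂, Matrix.of_apply, Matrix.submatrix_apply, hET, hE, hT,
      expMatrix_mul_toeplitz _ _ _ h0 hvan hch, expToeplitz, Matrix.map_apply, Matrix.of_apply,
      blockSwap_inr]
    simp [ρ, add_comm]
  have hLκ₂₁ : (L.submatrix κ κ).toBlocks₂₁ = 0 := by
    ext1 i k
    have : (κ (Sum.inr i)) < κ (Sum.inl k) := by
      rw [Fin.lt_def, blockSwap_inl, blockSwap_inr]; omega
    simp [Matrix.toBlocks₂₁, hL, toeplitz_of_lt cs this]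
  have hLκ₂₂ : (L.submatrix κ κ).toBlocks₂₂ = (toeplitz g cs).map (PowerSeries.C (R := ℚ)) := by
    ext1 i k
    simp [Matrix.toBlocks₂₂, hL, toeplitz, κ, blockSwap_inr]
  have hLρ₁₂ : (L.submatrix ρ ρ).toBlocks₁₂ = 0 := by
    ext1 i k
    have : (ρ (Sum.inl i)) < ρ (Sum.inr k) := by
      rw [Fin.lt_def]; simp [ρ]; omega
    simp [Matrix.toBlocks₁₂, hL, toeplitz_of_lt cs this]
  have hLρ₂₂ : (L.submatrix ρ ρ).toBlocks₂₂ = (toeplitz g cs).map (PowerSeries.C (R := ℚ)) := by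
    ext1 i k
    simp [Matrix.toBlocks₂₂, hL, toeplitz, ρ, PowerSeries.coeff_X_pow_mul', Nat.add_sub_add_left]
  have hB : ((L * (E' * T) * L).submatrix κ ρ).toBlocks₂₂ =
      (toeplitz g cs).map (PowerSeries.C (R := ℚ)) *
        (expToeplitz hs g e).map (PowerSeries.rescale (-1)) *
        (toeplitz g cs).map (PowerSeries.C (R := ℚ)) := by
    rw [← Matrix.submatrix_mul_equiv (L * (E' * T)) L κ ρ ρ,
      ← Matrix.submatrix_mul_equiv L (E' * T) κ κ ρ,
      ← Matrix.fromBlocks_toBlocks (L.submatrix κ κ), ← Matrix.fromBlocks_toBlocks (L.submatrix ρ ρ),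
      ← Matrix.fromBlocks_toBlocks ((E' * T).submatrix κ ρ), Matrix.fromBlocks_multiply,
      Matrix.fromBlocks_multiply, Matrix.toBlocks_fromBlocks₂₂, hLκ₂₁, hLκ₂₂, hLρ₁₂, hLρ₂₂, h22]
    simp
  have hdetL : ((toeplitz g cs).map (PowerSeries.C (R := ℚ))).det = 1 := by
    rw [← RingHom.mapMatrix_apply, ← RingHom.map_det, det_toeplitz _ _ h0, map_one]
  rw [h11, hB, Matrix.det_mul, Matrix.det_mul, hdetL, one_mul, mul_one,
    ← RingHom.mapMatrix_apply, ← RingHom.map_det] at hcomp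
  exact hcomp

theorem sum_eq_sum_strictAnti_perm {e : ℕ} (S : Finset (Fin e → ℕ))
    (hS : ∀ a ∈ S, ∀ σ : Equiv.Perm (Fin e), a ∘ σ ∈ S) (F : (Fin e → ℕ) → ℚ)
    (hF : ∀ a ∈ S, ¬ Function.Injective a → F a = 0) :
    ∑ a ∈ S, F a = ∑ b ∈ S with StrictAnti b, ∑ σ : Equiv.Perm (Fin e), F (b ∘ σ) := by
  classical
  rw [Finset.sum_sigma']
  symm
  refine Finset.sum_of_injOn (fun p => p.1 ∘ p.2) ?_ ?_ ?_ (fun _ _ => rfl)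
  · rintro ⟨b, σ⟩ hb ⟨b', σ'⟩ hb' h
    simp only [Finset.coe_sigma, Set.mem_sigma_iff, Finset.mem_coe, Finset.mem_filter] at hb hb' h
    have hr : Set.range b = Set.range b' := by
      rw [← σ.surjective.range_comp b, ← σ'.surjective.range_comp b', h]
    have hbb : b = b' := by
      have h1 : StrictMono (b ∘ Fin.rev) := hb.1.2.comp Fin.rev_strictAnti
      have h2 : StrictMono (b' ∘ Fin.rev) := hb'.1.2.comp Fin.rev_strictAnti
      have := (StrictMono.range_inj h1 h2).1 (by
        rw [Fin.rev_surjective.range_comp, Fin.rev_surjective.range_comp, hr])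
      funext i
      simpa using congrFun this (Fin.rev i)
    subst hbb
    congr 1
    ext1 i
    exact hb.1.2.injective (congrFun h i)
  · rintro ⟨b, σ⟩ hb
    simp only [Finset.coe_sigma, Set.mem_sigma_iff, Finset.mem_coe, Finset.mem_filter] at hb
    exact hS b hb.1.1 σ
  · intro a ha hna
    refine hF a ha fun hinj => hna ?_
    let τ : Equiv.Perm (Fin e) := Fin.revPerm.trans (Tuple.sort a)
    have hanti : StrictAnti (a ∘ τ) := by
      have h1 : StrictMono (a ∘ Tuple.sort a) :=
        (Tuple.monotone_sort a).strictMono_of_injective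
          (hinj.comp (Tuple.sort a).injective)
      exact h1.comp_strictAnti Fin.rev_strictAnti
    refine ⟨⟨a ∘ τ, τ⁻¹⟩, ?_, ?_⟩
    · simp only [Finset.coe_sigma, Set.mem_sigma_iff, Finset.mem_coe, Finset.mem_filter]
      exact ⟨⟨hS a ha τ, hanti⟩, Finset.mem_univ _⟩
    · funext i
      simp

theorem coeff_det_expToeplitz_eq_sum_piAntidiag (hs : PowerSeries ℚ) (e g N : ℕ) :
    PowerSeries.coeff N (expToeplitz hs e g).det =
      ∑ a ∈ piAntidiag (Finset.univ : Finset (Fin e)) (N + ∑ i : Fin e, (i : ℕ)),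
        (∏ i : Fin e, ((a i).descFactorial i : ℚ) / (a i).factorial) *
          (Matrix.of fun i k : Fin e =>
            PowerSeries.coeff (a i) (PowerSeries.X ^ ((k : ℕ) + g) * hs)).det := by
  have hexpand : PowerSeries.coeff N (expToeplitz hs e g).det =
      ∑ l ∈ finsuppAntidiag (Finset.univ : Finset (Fin e)) N,
        (∏ i : Fin e, ((l i).factorial : ℚ)⁻¹) *
          (Matrix.of fun i k : Fin e =>
            PowerSeries.coeff (l i + i) (PowerSeries.X ^ ((k : ℕ) + g) * hs)).det := by
    simp_rw [← Matrix.det_transpose (expToeplitz hs e g), ← Matrix.det_transpose (Matrix.of _),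
      Matrix.det_apply', Finset.mul_sum]
    rw [map_sum, Finset.sum_comm]
    refine Finset.sum_congr rfl fun σ _ => ?_
    rw [← zsmul_eq_mul, map_zsmul, PowerSeries.coeff_prod, zsmul_eq_mul, Finset.mul_sum]
    refine Finset.sum_congr rfl fun l _ => ?_
    rw [mul_left_comm, ← Finset.prod_mul_distrib]
    congr 1
    refine Finset.prod_congr rfl fun i _ => ?_
    simp only [Matrix.transpose_apply, expToeplitz, Matrix.of_apply, PowerSeries.coeff_mk]
    ring
  rw [hexpand]
  refine Finset.sum_of_injOn (fun l i => l i + (i : ℕ)) ?_ ?_ ?_ ?_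
  · intro l _ l' _ h
    ext i
    simpa using congrFun h i
  · intro l hl
    simp only [Finset.mem_coe, mem_finsuppAntidiag, mem_piAntidiag] at hl ⊢
    exact ⟨by rw [Finset.sum_add_distrib, hl.1], fun _ _ => Finset.mem_univ _⟩
  · intro a ha hna
    rw [mem_piAntidiag] at ha
    by_contra hne
    have hle : ∀ i : Fin e, (i : ℕ) ≤ a i := by
      intro i
      by_contra hlt
      refine hne ?_
      rw [Finset.prod_eq_zero (Finset.mem_univ i), zero_mul]
      rw [Nat.descFactorial_of_lt (not_le.1 hlt), Nat.cast_zero, zero_div]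
    refine hna ⟨Finsupp.equivFunOnFinite.symm fun i => a i - i, ?_, ?_⟩
    · simp only [Finset.mem_coe, mem_finsuppAntidiag, Finset.subset_univ, and_true]
      have : ∑ i : Fin e, (a i - (i : ℕ)) + ∑ i : Fin e, (i : ℕ) = ∑ i, a i := by
        rw [← Finset.sum_add_distrib]
        exact Finset.sum_congr rfl fun i _ => Nat.sub_add_cancel (hle i)
      have h2 : ∑ i, a i = N + ∑ i : Fin e, (i : ℕ) := ha.1
      simp only [Finsupp.equivFunOnFinite_symm_apply_apply]
      omega
    · funext i
      simp [hle i]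
  · intro l _
    congr 1
    refine Finset.prod_congr rfl fun i _ => ?_
    have := Nat.factorial_mul_descFactorial (Nat.le_add_left (i : ℕ) (l i))
    rw [Nat.add_sub_cancel] at this
    rw [← this]
    have h1 : ((l i).factorial : ℚ) ≠ 0 := by positivity
    have h2 : ((l i + (i : ℕ)).descFactorial i : ℚ) ≠ 0 := by
      rw [Nat.cast_ne_zero, Ne, Nat.descFactorial_eq_zero_iff_lt]; omega
    push_cast
    field_simp

theorem coeff_det_expToeplitz_eq_sum_strictAnti (hs : PowerSeries ℚ) (e g N : ℕ) :
    PowerSeries.coeff N (expToeplitz hs e g).det =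
      ∑ b ∈ piAntidiag (Finset.univ : Finset (Fin e)) (N + ∑ i : Fin e, (i : ℕ))
        with StrictAnti b,
        (Matrix.of fun i k : Fin e => ((b i).descFactorial k : ℚ) / (b i).factorial).det *
          (Matrix.of fun i k : Fin e =>
            PowerSeries.coeff (b i) (PowerSeries.X ^ ((k : ℕ) + g) * hs)).det := by
  rw [coeff_det_expToeplitz_eq_sum_piAntidiag, sum_eq_sum_strictAnti_perm]
  · refine Finset.sum_congr rfl fun b _ => ?_
    rw [Matrix.det_apply' (Matrix.of fun i k : Fin e => _ / _), Finset.sum_mul]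
    refine Finset.sum_congr rfl fun σ _ => ?_
    have := Matrix.det_permute σ (Matrix.of fun i k : Fin e =>
            PowerSeries.coeff (b i) (PowerSeries.X ^ ((k : ℕ) + g) * hs))
    rw [mul_right_comm, ← this, mul_comm]
    rfl
  · intro a ha σ
    rw [mem_piAntidiag] at ha ⊢
    refine ⟨?_, fun _ _ => Finset.mem_univ _⟩
    rw [← ha.1]
    exact Equiv.sum_comp σ a
  · intro a _ hinj
    simp only [Function.Injective, not_forall] at hinj
    obtain ⟨i, j, hij, hne⟩ := hinj
    rw [Matrix.det_zero_of_row_eq hne, mul_zero]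
    funext k
    simp [hij]

theorem StrictAnti.add_sub_le_fin {e : ℕ} {b : Fin e → ℕ} (hb : StrictAnti b) {i j : Fin e}
    (hij : i ≤ j) : b j + ((j : ℕ) - i) ≤ b i := by
  obtain ⟨d, hd⟩ := Nat.exists_eq_add_of_le (Fin.le_def.1 hij)
  induction d generalizing j with
  | zero => rw [show j = i from Fin.ext hd]; simp
  | succ d ih =>
    have hlt : (i : ℕ) + d < e := by omega
    have h1 := @ih ⟨i + d, hlt⟩ (by simp [Fin.le_def]) rfl
    have h2 : b j < b ⟨i + d, hlt⟩ := hb (by rw [Fin.lt_def]; simp; omega)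
    simp only at h1
    omega

theorem sum_fin_rev (e : ℕ) : ∑ i : Fin e, (e - 1 - (i : ℕ)) = ∑ i : Fin e, (i : ℕ) := by
  rw [← Equiv.sum_comp Fin.revPerm]
  refine Finset.sum_congr rfl fun i _ => ?_
  simp only [Fin.revPerm_apply, Fin.val_rev]
  omega

theorem le_of_det_coeff_ne_zero {hs : PowerSeries ℚ} {e g : ℕ} {b : Fin e → ℕ}
    (hdet : (Matrix.of fun i k : Fin e =>
      PowerSeries.coeff (b i) (PowerSeries.X ^ ((k : ℕ) + g) * hs)).det ≠ 0) (i : Fin e) :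
    g ≤ b i := by
  by_contra hlt
  refine hdet (Matrix.det_eq_zero_of_row_eq_zero i fun k => ?_)
  rw [Matrix.of_apply, PowerSeries.coeff_X_pow_mul', if_neg (by omega)]

theorem StrictAnti.add_rev_le_fin {e g : ℕ} {b : Fin e → ℕ} (hb : StrictAnti b)
    (hg : ∀ i, g ≤ b i) (i : Fin e) : g + (e - 1 - (i : ℕ)) ≤ b i := by
  have hi := i.isLt
  have := hb.add_sub_le_fin (i := i) (j := ⟨e - 1, by omega⟩) (Fin.le_def.2 (by simp only; omega))
  have := hg ⟨e - 1, by omega⟩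
  simp only at *
  omega

theorem coeff_det_expToeplitz_of_lt (hs : PowerSeries ℚ) {e g N : ℕ} (hN : N < e * g) :
    PowerSeries.coeff N (expToeplitz hs e g).det = 0 := by
  rw [coeff_det_expToeplitz_eq_sum_strictAnti]
  refine Finset.sum_eq_zero fun b hb => ?_
  rw [Finset.mem_filter, mem_piAntidiag] at hb
  by_contra hne
  have hle := hb.2.add_rev_le_fin (le_of_det_coeff_ne_zero (right_ne_zero_of_mul hne))
  have := Finset.sum_le_sum fun i (_ : i ∈ Finset.univ) => hle i
  rw [Finset.sum_add_distrib, sum_fin_rev, Finset.sum_const, Finset.card_univ, Fintype.card_fin,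
    smul_eq_mul, hb.1.1] at this
  omega

theorem coeff_det_expToeplitz_eq_sum_partitionsOf (hs : PowerSeries ℚ) (e g q : ℕ) :
    PowerSeries.coeff (q + e * g) (expToeplitz hs e g).det =
      ∑ lam ∈ partitionsOf e q,
        (Matrix.of fun i k : Fin e => ((lam i + g + (e - 1 - i)).descFactorial k : ℚ) /
          (lam i + g + (e - 1 - i)).factorial).det *
        (Matrix.of fun i k : Fin e =>
          PowerSeries.coeff (lam i + (e - 1 - i)) (PowerSeries.X ^ (k : ℕ) * hs)).det := by
  rw [coeff_det_expToeplitz_eq_sum_strictAnti]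
  symm
  refine Finset.sum_of_injOn (fun lam i => lam i + g + (e - 1 - (i : ℕ))) ?_ ?_ ?_ ?_
  · intro lam _ lam' _ h
    funext i
    have := congrFun h i
    simp only at this
    omega
  · intro lam hlam
    simp only [partitionsOf, Finset.coe_filter, Set.mem_ofPred_eq, mem_piAntidiag] at hlam ⊢
    refine ⟨⟨?_, fun _ _ => Finset.mem_univ _⟩, ?_⟩
    · rw [Finset.sum_add_distrib, Finset.sum_add_distrib, sum_fin_rev, Finset.sum_const,
        Finset.card_univ, Fintype.card_fin, smul_eq_mul, hlam.2.2]
    · intro i j hij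
      have := hlam.2.1 i j hij.le
      rw [Fin.lt_def] at hij
      simp only
      omega
  · intro b hb hnb
    rw [Finset.mem_filter, mem_piAntidiag] at hb
    by_contra hne
    have hle := hb.2.add_rev_le_fin (le_of_det_coeff_ne_zero (right_ne_zero_of_mul hne))
    refine hnb ⟨fun i => b i - (g + (e - 1 - (i : ℕ))), ?_, ?_⟩
    · have hsum : ∑ i, (b i - (g + (e - 1 - (i : ℕ)))) = q := by
        have h1 : ∑ i, (b i - (g + (e - 1 - (i : ℕ)))) + ∑ i : Fin e, (g + (e - 1 - (i : ℕ))) =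
            ∑ i, b i := by
          rw [← Finset.sum_add_distrib]
          exact Finset.sum_congr rfl fun i _ => Nat.sub_add_cancel (hle i)
        rw [Finset.sum_add_distrib, sum_fin_rev, Finset.sum_const,
          Finset.card_univ, Fintype.card_fin, smul_eq_mul, hb.1.1] at h1
        omega
      simp only [partitionsOf, Finset.coe_filter, Set.mem_ofPred_eq, Fintype.mem_piFinset,
        Finset.mem_range]
      refine ⟨fun i => ?_, ?_, hsum⟩
      · rw [Nat.lt_succ_iff, ← hsum]
        exact Finset.single_le_sum (f := fun i => b i - (g + (e - 1 - (i : ℕ))))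
          (fun _ _ => Nat.zero_le _) (Finset.mem_univ i)
      · intro i j hij
        have := hb.2.add_sub_le_fin hij
        rw [Fin.le_def] at hij
        omega
    · funext i
      have := hle i
      simp only
      omega
  · intro lam _
    congr 2
    ext i k
    simp only [Matrix.of_apply]
    rw [show lam i + g + (e - 1 - (i : ℕ)) = lam i + (e - 1 - i) + g by ring,
      add_comm (k : ℕ) g, pow_add, mul_assoc, PowerSeries.coeff_X_pow_mul]

theorem det_descFactorial {e : ℕ} (b : Fin e → ℕ) :
    (Matrix.of fun i k : Fin e => ((b i).descFactorial k : ℚ)).det =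
      ∏ i : Fin e, ∏ j ∈ Finset.Ioi i, ((b j : ℚ) - b i) := by
  rw [← Matrix.det_vandermonde fun i => (b i : ℚ),
    Matrix.det_eval_matrixOfPolynomials_eq_det_vandermonde _ fun k => descPochhammer ℚ k]
  · simp only [descPochhammer_eval_eq_descFactorial]
  · exact fun i => descPochhammer_natDegree ℚ i
  · exact fun i => monic_descPochhammer ℚ i

theorem det_descFactorial_div_factorial {e : ℕ} (b : Fin e → ℕ) :
    (Matrix.of fun i k : Fin e => ((b i).descFactorial k : ℚ) / (b i).factorial).det =
      (∏ i : Fin e, ∏ j ∈ Finset.Ioi i, ((b j : ℚ) - b i)) / ∏ i, ((b i).factorial : ℚ) := by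
  rw [← det_descFactorial, div_eq_inv_mul, ← Finset.prod_inv_distrib, ← Matrix.det_mul_column]
  congr 1
  ext i k
  simp only [Matrix.of_apply]
  ring

theorem coeff_one_add_X_pow_rat (n k : ℕ) :
    PowerSeries.coeff k ((1 + PowerSeries.X : PowerSeries ℚ) ^ n) = (n.choose k : ℚ) := by
  have := Polynomial.coeff_one_add_X_pow ℚ n k
  rw [← Polynomial.coeff_coe] at this
  simpa using this

/-- Column operations based on Pascal's rule. -/
theorem det_coeff_one_add_X_pow {e : ℕ} (p : ℕ) (β : Fin e → ℕ) :
    (Matrix.of fun i k : Fin e => PowerSeries.coeff (β i)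
      (PowerSeries.X ^ (k : ℕ) * (1 + PowerSeries.X : PowerSeries ℚ) ^ (p + 1))).det =
    (Matrix.of fun i k : Fin e => PowerSeries.coeff (β i)
      (PowerSeries.X ^ (k : ℕ) * (1 + PowerSeries.X : PowerSeries ℚ) ^ (p + e - k))).det := by
  set U : Matrix (Fin e) (Fin e) ℚ := Matrix.of fun j k =>
    PowerSeries.coeff (j : ℕ) (PowerSeries.X ^ (k : ℕ) *
      (1 + PowerSeries.X : PowerSeries ℚ) ^ (e - 1 - k : ℕ)) with hU
  have hUdet : U.det = 1 := by
    rw [← Matrix.det_transpose, Matrix.det_of_isUpperTriangular]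
    · refine Finset.prod_eq_one fun i _ => ?_
      rw [Matrix.transpose_apply, hU, Matrix.of_apply, PowerSeries.coeff_X_pow_mul',
        if_pos le_rfl, Nat.sub_self, coeff_one_add_X_pow_rat]
      simp
    · intro i k h
      rw [Matrix.transpose_apply, hU, Matrix.of_apply, PowerSeries.coeff_X_pow_mul',
        if_neg (by simpa using h)]
  rw [← mul_one (Matrix.det _), ← hUdet, ← Matrix.det_mul]
  congr 1
  ext i k
  have hk := k.isLt
  rw [Matrix.mul_apply]
  simp only [Matrix.of_apply, hU]
  have hpoly : PowerSeries.X ^ (k : ℕ) * (1 + PowerSeries.X : PowerSeries ℚ) ^ (e - 1 - k : ℕ) =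
      ∑ j : Fin e, PowerSeries.C (PowerSeries.coeff (j : ℕ) (PowerSeries.X ^ (k : ℕ) *
        (1 + PowerSeries.X : PowerSeries ℚ) ^ (e - 1 - k : ℕ))) * PowerSeries.X ^ (j : ℕ) := by
    ext l
    rw [map_sum, Fin.sum_univ_eq_sum_range (fun j => PowerSeries.coeff l
      (PowerSeries.C (PowerSeries.coeff j (PowerSeries.X ^ (k : ℕ) *
        (1 + PowerSeries.X : PowerSeries ℚ) ^ (e - 1 - k : ℕ))) * PowerSeries.X ^ j)) e]
    simp only [PowerSeries.coeff_C_mul, PowerSeries.coeff_X_pow, mul_ite, mul_one, mul_zero]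
    rw [Finset.sum_ite_eq]
    split_ifs with hl
    · rfl
    · rw [Finset.mem_range] at hl
      rw [PowerSeries.coeff_X_pow_mul', coeff_one_add_X_pow_rat, if_pos (by omega),
        Nat.choose_eq_zero_of_lt (by omega), Nat.cast_zero]
  rw [show p + e - (k : ℕ) = (e - 1 - k) + (p + 1) by omega,
    pow_add _ (e - 1 - (k : ℕ)), ← mul_assoc (PowerSeries.X ^ (k : ℕ))]
  conv_rhs => rw [hpoly]
  rw [Finset.sum_mul, map_sum]
  refine Finset.sum_congr rfl fun j _ => ?_
  rw [mul_assoc, PowerSeries.coeff_C_mul, mul_comm]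

theorem det_coeff_one_add_X_pow_eq_prod {e : ℕ} (p : ℕ) (β : Fin e → ℕ)
    (hβ : ∀ i, β i ≤ p + e) :
    (Matrix.of fun i k : Fin e => PowerSeries.coeff (β i)
      (PowerSeries.X ^ (k : ℕ) * (1 + PowerSeries.X : PowerSeries ℚ) ^ (p + 1))).det =
    (∏ i : Fin e, ((p + (i + 1)).factorial : ℚ) / (p + e - β i).factorial) *
      ((∏ i : Fin e, ∏ j ∈ Finset.Ioi i, ((β j : ℚ) - β i)) / ∏ i, ((β i).factorial : ℚ)) := by
  have hentry : ∀ i k : Fin e, PowerSeries.coeff (β i)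
      (PowerSeries.X ^ (k : ℕ) * (1 + PowerSeries.X : PowerSeries ℚ) ^ (p + e - k)) =
      ((p + e - k).factorial : ℚ) * ((((p + e - β i).factorial : ℚ))⁻¹ *
        (((β i).descFactorial k : ℚ) / (β i).factorial)) := by
    intro i k
    have hk := k.isLt
    have hi := hβ i
    rw [PowerSeries.coeff_X_pow_mul', coeff_one_add_X_pow_rat]
    split_ifs with h
    · have h1 := Nat.choose_mul_factorial_mul_factorial (n := p + e - k) (k := β i - k) (by omega)
      have h2 := Nat.factorial_mul_descFactorial h
      rw [show p + e - (k : ℕ) - (β i - k) = p + e - β i by omega] at h1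
      rw [← h1, ← h2]
      have h3 : ((β i).descFactorial k : ℚ) ≠ 0 := by
        rw [Nat.cast_ne_zero, Ne, Nat.descFactorial_eq_zero_iff_lt]; omega
      have h4 : ((β i - k).factorial : ℚ) ≠ 0 := by positivity
      have h5 : ((p + e - β i).factorial : ℚ) ≠ 0 := by positivity
      push_cast
      field_simp
    · rw [Nat.descFactorial_of_lt (by omega)]
      simp
  rw [det_coeff_one_add_X_pow]
  have hmat : (Matrix.of fun i k : Fin e => PowerSeries.coeff (β i)
      (PowerSeries.X ^ (k : ℕ) * (1 + PowerSeries.X : PowerSeries ℚ) ^ (p + e - k))) =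
      Matrix.of fun i k : Fin e => ((p + e - k).factorial : ℚ) *
        (Matrix.of fun i k : Fin e => (((p + e - β i).factorial : ℚ))⁻¹ *
          (Matrix.of fun i k : Fin e => ((β i).descFactorial k : ℚ) / (β i).factorial) i k) i k := by
    ext i k
    exact hentry i k
  have hrev : ∏ k : Fin e, ((p + e - k).factorial : ℚ) =
      ∏ i : Fin e, ((p + ((i : ℕ) + 1)).factorial : ℚ) := by
    rw [← Equiv.prod_comp Fin.revPerm]
    refine Finset.prod_congr rfl fun i _ => ?_
    rw [Fin.revPerm_apply, Fin.val_rev]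
    congr 2
    omega
  rw [hmat, Matrix.det_mul_row, Matrix.det_mul_column, det_descFactorial_div_factorial, hrev,
    Finset.prod_div_distrib, Finset.prod_inv_distrib, ← mul_assoc, ← div_eq_mul_inv]

theorem det_coeff_congr {e q : ℕ} {u v : PowerSeries ℚ}
    (huv : ∀ i ≤ q, PowerSeries.coeff i u = PowerSeries.coeff i v) {β : Fin e → ℕ}
    (hβ : ∑ i, β i = q + ∑ i : Fin e, (i : ℕ)) :
    (Matrix.of fun i k : Fin e => PowerSeries.coeff (β i) (PowerSeries.X ^ (k : ℕ) * u)).det =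
    (Matrix.of fun i k : Fin e => PowerSeries.coeff (β i) (PowerSeries.X ^ (k : ℕ) * v)).det := by
  rw [Matrix.det_apply', Matrix.det_apply']
  refine Finset.sum_congr rfl fun σ _ => ?_
  congr 1
  simp only [Matrix.of_apply, PowerSeries.coeff_X_pow_mul']
  by_cases h : ∀ i : Fin e, (i : ℕ) ≤ β (σ i)
  · refine Finset.prod_congr rfl fun i _ => ?_
    rw [if_pos (h i), if_pos (h i)]
    refine huv _ ?_
    have h1 : ∑ i, (β (σ i) - (i : ℕ)) + ∑ i : Fin e, (i : ℕ) = ∑ i, β (σ i) := by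
      rw [← Finset.sum_add_distrib]
      exact Finset.sum_congr rfl fun i _ => Nat.sub_add_cancel (h i)
    rw [Equiv.sum_comp σ β, hβ] at h1
    have h2 := Finset.single_le_sum (f := fun i => β (σ i) - (i : ℕ))
      (fun _ _ => Nat.zero_le _) (Finset.mem_univ i)
    omega
  · push Not at h
    obtain ⟨i, hi⟩ := h
    rw [Finset.prod_eq_zero (Finset.mem_univ i) (if_neg (by omega)),
      Finset.prod_eq_zero (Finset.mem_univ i) (if_neg (by omega))]

theorem fSYT_eq (e : ℕ) (lam : Fin e → ℕ) :
    fSYT e lam = ((∑ i, lam i).factorial : ℚ) *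
      ((∏ i : Fin e, ∏ j ∈ Finset.Ioi i,
        (((lam i + (e - 1 - i) : ℕ) : ℚ) - ((lam j + (e - 1 - j) : ℕ) : ℚ))) /
      ∏ i : Fin e, ((lam i + (e - 1 - i)).factorial : ℚ)) := by
  rw [fSYT, mul_div_assoc]
  congr 2
  · refine Finset.prod_congr rfl fun i _ => Finset.prod_congr rfl fun j _ => ?_
    have hi := i.isLt
    have hj := j.isLt
    rw [Nat.sub_sub, Nat.sub_sub, Nat.cast_add, Nat.cast_add, Nat.cast_sub (by omega),
      Nat.cast_sub (by omega)]
    push_cast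
    ring
  · refine Finset.prod_congr rfl fun i _ => ?_
    have hi := i.isLt
    rw [show lam i + e - 1 - (i : ℕ) = lam i + (e - 1 - i) by omega]

theorem det_mul_det_eq_fSYT {e g p q : ℕ} (hqp : q ≤ p) {hs : PowerSeries ℚ}
    (hhs : ∀ i ≤ q, PowerSeries.coeff i hs = ((p + 1).choose i : ℚ)) {lam : Fin e → ℕ}
    (hlam : lam ∈ partitionsOf e q) :
    (Matrix.of fun i k : Fin e => ((lam i + g + (e - 1 - i)).descFactorial k : ℚ) /
          (lam i + g + (e - 1 - i)).factorial).det *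
        (Matrix.of fun i k : Fin e =>
          PowerSeries.coeff (lam i + (e - 1 - i)) (PowerSeries.X ^ (k : ℕ) * hs)).det =
    fSYT e lam * fSYT e (fun i => lam i + g) *
      (∏ i : Fin e, ((p + ((i : ℕ) + 1)).factorial : ℚ) /
        ((p + ((i : ℕ) + 1) - lam i).factorial : ℚ)) /
      ((q.factorial : ℚ) * ((q + e * g).factorial : ℚ)) := by
  simp only [partitionsOf, Finset.mem_filter, Fintype.mem_piFinset, Finset.mem_range] at hlam
  obtain ⟨hle, -, hsum⟩ := hlam
  rw [det_coeff_congr (q := q) (v := (1 + PowerSeries.X) ^ (p + 1))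
    (fun i hi => by rw [hhs i hi, coeff_one_add_X_pow_rat])
    (by rw [Finset.sum_add_distrib, hsum, sum_fin_rev]),
    det_coeff_one_add_X_pow_eq_prod p _ (fun i => by have := hle i; have := i.isLt; omega),
    det_descFactorial_div_factorial fun i : Fin e => lam i + g + (e - 1 - i), fSYT_eq, fSYT_eq,
    hsum, Finset.sum_add_distrib, hsum, Finset.sum_const, Finset.card_univ, Fintype.card_fin,
    smul_eq_mul]
  have hprod : (∏ i : Fin e, ((p + ((i : ℕ) + 1)).factorial : ℚ) /
      ((p + e - (lam i + (e - 1 - i))).factorial : ℚ)) =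
      ∏ i : Fin e, ((p + ((i : ℕ) + 1)).factorial : ℚ) /
        ((p + ((i : ℕ) + 1) - lam i).factorial : ℚ) := by
    refine Finset.prod_congr rfl fun i _ => ?_
    have hi := i.isLt
    have := hle i
    rw [show p + e - (lam i + (e - 1 - (i : ℕ))) = p + (i + 1) - lam i by omega]
  rw [hprod]
  have hswap : ∀ b c : Fin e → ℕ,
      (∏ i : Fin e, ∏ j ∈ Finset.Ioi i, ((b j : ℚ) - b i)) *
        (∏ i : Fin e, ∏ j ∈ Finset.Ioi i, ((c j : ℚ) - c i)) =
      (∏ i : Fin e, ∏ j ∈ Finset.Ioi i, ((c i : ℚ) - c j)) *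
        (∏ i : Fin e, ∏ j ∈ Finset.Ioi i, ((b i : ℚ) - b j)) := by
    intro b c
    simp only [← Finset.prod_mul_distrib]
    refine Finset.prod_congr rfl fun i _ => Finset.prod_congr rfl fun j _ => ?_
    ring
  have hq : (q.factorial : ℚ) ≠ 0 := by positivity
  have hM : ((q + e * g).factorial : ℚ) ≠ 0 := by positivity
  have key := hswap (fun i => lam i + g + (e - 1 - i)) (fun i => lam i + (e - 1 - i))
  rw [div_mul_eq_mul_div, ← mul_div_assoc, ← mul_div_assoc, mul_left_comm, key]
  field_simp

theorem coeff_det_expToeplitz_eq_sum_fSYT (e g : ℕ) {p q : ℕ} (hqp : q ≤ p) {hs : PowerSeries ℚ}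
    (hhs : ∀ i ≤ q, PowerSeries.coeff i hs = ((p + 1).choose i : ℚ)) :
    PowerSeries.coeff (q + e * g) (expToeplitz hs e g).det =
      (∑ lam ∈ partitionsOf e q, fSYT e lam * fSYT e (fun i => lam i + g) *
        ∏ i : Fin e, ((p + ((i : ℕ) + 1)).factorial : ℚ) /
          ((p + ((i : ℕ) + 1) - lam i).factorial : ℚ)) /
      ((q.factorial : ℚ) * ((q + e * g).factorial : ℚ)) := by
  rw [coeff_det_expToeplitz_eq_sum_partitionsOf, Finset.sum_div]
  exact Finset.sum_congr rfl fun lam hlam => det_mul_det_eq_fSYT hqp hhs hlam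

theorem exists_mul_eq_one_truncated (p r : ℕ) (hr : 0 < r) :
    ∃ cs hs : PowerSeries ℚ, PowerSeries.coeff 0 cs = 1 ∧
      (∀ i, r < i → PowerSeries.coeff i cs = 0) ∧ cs * hs = 1 ∧
      PowerSeries.coeff 1 cs = -((p : ℚ) + 1) ∧
      ∀ i ≤ r, PowerSeries.coeff i hs = ((p + 1).choose i : ℚ) := by
  set u : PowerSeries ℚ := (1 + PowerSeries.X) ^ (p + 1) with hu
  have hcu : ∀ i, PowerSeries.coeff i u = ((p + 1).choose i : ℚ) := coeff_one_add_X_pow_rat _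
  have hu0 : PowerSeries.constantCoeff u ≠ 0 := by
    rw [← PowerSeries.coeff_zero_eq_constantCoeff_apply, hcu]; simp
  set cs : PowerSeries ℚ := ((PowerSeries.trunc (r + 1) u⁻¹ : Polynomial ℚ) : PowerSeries ℚ)
    with hcs
  have hccs : ∀ i, PowerSeries.coeff i cs = if i < r + 1 then PowerSeries.coeff i u⁻¹ else 0 := by
    intro i
    rw [hcs, Polynomial.coeff_coe, PowerSeries.coeff_trunc]
  have hcoeff : ∀ i ≤ r, ∀ v : PowerSeries ℚ,
      PowerSeries.coeff i (cs * v) = PowerSeries.coeff i (u⁻¹ * v) := by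
    intro i hi v
    rw [PowerSeries.coeff_mul, PowerSeries.coeff_mul]
    refine Finset.sum_congr rfl fun x hx => ?_
    have := Finset.HasAntidiagonal.mem_antidiagonal.1 hx
    rw [hccs, if_pos (by omega)]
  have huinv : u⁻¹ * u = 1 := PowerSeries.inv_mul_cancel u hu0
  have hc0 : PowerSeries.coeff 0 cs = 1 := by
    rw [hccs, if_pos (Nat.succ_pos r), PowerSeries.coeff_zero_eq_constantCoeff_apply,
      PowerSeries.constantCoeff_inv, ← PowerSeries.coeff_zero_eq_constantCoeff_apply, hcu]
    simp
  have hcs0 : PowerSeries.constantCoeff cs ≠ 0 := by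
    rw [← PowerSeries.coeff_zero_eq_constantCoeff_apply, hc0]; exact one_ne_zero
  have hch : cs * cs⁻¹ = 1 := PowerSeries.mul_inv_cancel cs hcs0
  have hhs : ∀ i ≤ r, PowerSeries.coeff i cs⁻¹ = ((p + 1).choose i : ℚ) := by
    intro i hi
    have hdiff : u - cs⁻¹ = cs⁻¹ * (cs * u - 1) := by linear_combination -u * hch
    rw [← hcu, eq_comm, ← sub_eq_zero, ← map_sub, hdiff, PowerSeries.coeff_mul]
    refine Finset.sum_eq_zero fun x hx => ?_
    have := Finset.HasAntidiagonal.mem_antidiagonal.1 hx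
    rw [map_sub, hcoeff _ (by omega), huinv, sub_self, mul_zero]
  refine ⟨cs, cs⁻¹, hc0, fun i hi => by rw [hccs, if_neg (by omega)], hch, ?_, hhs⟩
  have h1 := congrArg (PowerSeries.coeff 1) hch
  rw [PowerSeries.coeff_mul, Finset.Nat.sum_antidiagonal_eq_sum_range_succ_mk,
    Finset.sum_range_succ, Finset.sum_range_one, Nat.sub_zero, Nat.sub_self, hc0, hhs 1 hr,
    hhs 0 (Nat.zero_le r), PowerSeries.coeff_one, if_neg one_ne_zero, Nat.choose_one_right,
    Nat.choose_zero_right] at h1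
  push_cast at h1
  linarith

theorem sum_fSYT_eq_sum_sum_fSYT (n e g : ℕ) (hr : 0 < e + g) (hnr : n ≤ e + g) :
    (∑ lam ∈ partitionsOf e n, fSYT e lam * fSYT e (fun i => lam i + g) *
      ∏ i : Fin e, ((n + ((i : ℕ) + 1)).factorial : ℚ) /
        ((n + ((i : ℕ) + 1) - lam i).factorial : ℚ)) =
    (n.factorial : ℚ) * ∑ k ∈ Finset.range (n + 1),
      ((-1 : ℚ) ^ (n - k) * ((n : ℚ) + 1) ^ k / ((n - k).factorial : ℚ)) *
        ((n + e * g).choose k : ℚ) *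
        ∑ lam ∈ partitionsOf g (n - k), fSYT g lam * fSYT g (fun i => lam i + e) *
          ∏ i : Fin g, ((n + ((i : ℕ) + 1)).factorial : ℚ) /
            ((n + ((i : ℕ) + 1) - lam i).factorial : ℚ) := by
  obtain ⟨cs, hs, h0, hvan, hch, h1, hhs⟩ := exists_mul_eq_one_truncated n (e + g) hr
  have key := congrArg (PowerSeries.coeff (n + e * g))
    (det_expToeplitz_duality cs hs e g hr h0 hvan hch)
  have hsign : ((-1 : PowerSeries ℚ)) ^ (e * g) = PowerSeries.C ((-1 : ℚ) ^ (e * g)) := by simp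
  rw [coeff_det_expToeplitz_eq_sum_fSYT e g le_rfl fun i hi => hhs i (hi.trans hnr), hsign,
    mul_assoc, PowerSeries.coeff_C_mul, h1, neg_neg, PowerSeries.coeff_mul,
    Finset.Nat.sum_antidiagonal_eq_sum_range_succ_mk,
    ← Finset.sum_subset (Finset.range_subset_range.2 (by omega : n + 1 ≤ (n + e * g).succ)),
    div_eq_iff (by positivity), Finset.mul_sum, Finset.sum_mul] at key
  · rw [key, Finset.mul_sum]
    refine Finset.sum_congr rfl fun k hk => ?_
    have hkn : k ≤ n := Nat.lt_succ_iff.1 (Finset.mem_range.1 hk)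
    have hMk : n + e * g - k = (n - k) + g * e := by rw [mul_comm g e]; omega
    simp only
    rw [PowerSeries.coeff_rescale, PowerSeries.coeff_rescale, PowerSeries.coeff_exp, hMk,
      coeff_det_expToeplitz_eq_sum_fSYT g e (Nat.sub_le n k)
        fun i hi => hhs i ((hi.trans (Nat.sub_le n k)).trans hnr),
      Nat.cast_choose ℚ (show k ≤ n + e * g by omega), hMk]
    have hs2 : (-1 : ℚ) ^ (e * g) * (-1 : ℚ) ^ (n - k + g * e) = (-1) ^ (n - k) := by
      rw [pow_add, mul_comm g e, mul_left_comm, ← mul_pow]; simp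
    rw [← hs2]
    simp only [one_div, eq_ratCast, Rat.cast_inv, Rat.cast_natCast, Algebra.algebraMap_self]
    field_simp
  · intro k hkM hk
    rw [Finset.mem_range] at hkM hk
    have h : n + e * g - k < g * e := by rw [mul_comm g e]; omega
    simp only
    rw [PowerSeries.coeff_rescale (f := (expToeplitz hs g e).det),
      coeff_det_expToeplitz_of_lt hs h, mul_zero, mul_zero]

theorem two_mul_add_one_le_choose (n : ℕ) {d : ℕ} (hd : 2 ≤ d) :
    2 * n + 1 ≤ (n + d).choose d := by
  have h : (n + 2).choose n ≤ (n + d).choose n := Nat.choose_le_choose n (by omega)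
  rw [← Nat.choose_symm_add]
  refine le_trans ?_ h
  rw [Nat.choose_symm_add, Nat.choose_two_right, Nat.le_div_iff_mul_le two_pos,
    show n + 2 - 1 = n + 1 from rfl]
  have : n ≤ n * n := Nat.le_mul_self n
  nlinarith

/-- Agreement of the two degree formulas (Theorems 0.1 and 2.10) for the
Veronese variety: with N = C(n+d,d) - 1, n <= m <= N - 1,
M = n + (N-m)(m-n), eps = ((m-n)^{N-m}), eps' = ((N-m)^{m-n}),
sum_{|lam|=n, length N-m} f^lam f^{lam+eps} prod_{i=1}^{N-m} (n+i)!/(n+i-lam_i)!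
= n! * sum_{k=0}^{n} ((-1)^{n-k} (n+1)^k / (n-k)!) * C(M,k) *
  sum_{|lam'|=n-k, length m-n} f^{lam'} f^{lam'+eps'}
    prod_{i=1}^{m-n} (n+i)!/(n+i-lam'_i)!. -/
theorem two_degree_formulas_agree (n d : ℕ) (hn : 0 < n) (hd : 2 ≤ d)
    (N : ℕ) (hNdef : N = (n + d).choose d - 1)
    (m : ℕ) (hnm : n ≤ m) (hmN : m + 1 ≤ N) :
    (∑ lam ∈ partitionsOf (N - m) n,
        fSYT (N - m) lam * fSYT (N - m) (fun i => lam i + (m - n)) *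
          ∏ i : Fin (N - m),
            ((n + ((i : ℕ) + 1)).factorial : ℚ) /
              ((n + ((i : ℕ) + 1) - lam i).factorial : ℚ))
    = (n.factorial : ℚ) *
        ∑ k ∈ Finset.range (n + 1),
          ((-1 : ℚ) ^ (n - k) * ((n : ℚ) + 1) ^ k / ((n - k).factorial : ℚ)) *
            (((n + (N - m) * (m - n)).choose k : ℚ)) *
            ∑ lam ∈ partitionsOf (m - n) (n - k),
              fSYT (m - n) lam * fSYT (m - n) (fun i => lam i + (N - m)) *
                ∏ i : Fin (m - n),
                  ((n + ((i : ℕ) + 1)).factorial : ℚ) /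
                    ((n + ((i : ℕ) + 1) - lam i).factorial : ℚ) := by
  have hN := two_mul_add_one_le_choose n hd
  exact sum_fSYT_eq_sum_sum_fSYT n (N - m) (m - n) (by omega) (by omega)
end

section
/- Let m ≥ 3 and e ≥ 2 be integers, and set N := m + e and M := 3 + (m−3)e. Then f^{(m−1, m−2, (m−3)^{e−2})} = [2(e+1)e(e−1) / ((N−2)(N−3)(N−4))] · C(M, 3) · f^{((m−3)^e)}, where (m−1, m−2, (m−3)^{e−2}) denotes the partition of length e with parts m − 1 and m − 2 followed by e − 2 parts equal to m − 3, and ((m−3)^e) denotes e copies of m − 3. -/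
open Finset

/-- The telescoping product `∏ (j + 4) / (j + 1) = C(k + 3, 3)`, cleared of denominators. -/
theorem six_mul_prod_add_four (k : ℕ) :
    6 * ∏ j : Fin k, (((j : ℕ) : ℚ) + 4) =
      ((k : ℚ) + 1) * (k + 2) * (k + 3) * ∏ j : Fin k, (((j : ℕ) : ℚ) + 1) := by
  induction k with
  | zero => norm_num
  | succ k ih =>
    rw [Fin.prod_univ_castSucc, Fin.prod_univ_castSucc]
    simp only [Fin.val_castSucc, Fin.val_last]
    push_cast
    linear_combination ((k : ℚ) + 4) * ih

/-- `fSYT` of the shape `(a + p, a + q, a, …, a)`, with the factors involving the first two rows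
written separately from those of the remaining rectangle. -/
theorem fSYT_two_rows_over_rectangle (k a p q : ℕ) :
    fSYT (k + 2) (fun i => if (i : ℕ) = 0 then a + p else if (i : ℕ) = 1 then a + q else a) =
      ((p + q + a * (k + 2)).factorial : ℚ) *
        (((p : ℚ) - q + 1) * (∏ j : Fin k, (((j : ℕ) : ℚ) + (p + 2))) *
          ((∏ j : Fin k, (((j : ℕ) : ℚ) + (q + 1))) *
            ∏ i : Fin k, ∏ j ∈ Finset.Ioi i, (((j : ℕ) : ℚ) - ((i : ℕ) : ℚ)))) /
        (((a + p + k + 1).factorial : ℚ) * (((a + q + k).factorial : ℚ) *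
          ∏ i : Fin k, ((a + k - 1 - (i : ℕ)).factorial : ℚ))) := by
  unfold fSYT
  have hsum : (∑ i : Fin (k + 2),
      if (i : ℕ) = 0 then a + p else if (i : ℕ) = 1 then a + q else a) =
        p + q + a * (k + 2) := by
    simp only [Fin.sum_univ_succ, Fin.val_succ, Fin.val_zero]
    simp
    ring
  rw [hsum]
  simp only [Fin.prod_univ_succ, Fin.prod_Ioi_zero, Fin.prod_Ioi_succ, Fin.val_succ, Fin.val_zero]
  simp only [if_true, Nat.add_eq_zero_iff, one_ne_zero, and_false, if_false, zero_add,
    Nat.add_eq_right]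
  congr 1
  · congr 1
    congr 1
    · congr 1
      · push_cast
        ring
      · refine Finset.prod_congr rfl fun j _ => ?_
        push_cast
        ring
    · congr 1
      · refine Finset.prod_congr rfl fun j _ => ?_
        push_cast
        ring
      · refine Finset.prod_congr rfl fun i _ => Finset.prod_congr rfl fun j _ => ?_
        push_cast
        ring
  · congr 1
    congr 1
    refine Finset.prod_congr rfl fun i _ => ?_
    congr 2
    omega

/-- For m >= 3, e >= 2, N := m + e, M := 3 + (m-3)e:
f^{(m-1, m-2, (m-3)^{e-2})} = [2(e+1)e(e-1) / ((N-2)(N-3)(N-4))] * C(M,3) * f^{((m-3)^e)},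
all shapes of length e. -/
theorem fSYT_threefold_second (m e N M : ℕ) (hm : 3 ≤ m) (he : 2 ≤ e)
    (hN : N = m + e) (hM : M = 3 + (m - 3) * e) :
    fSYT e (fun i => if (i : ℕ) = 0 then m - 1 else if (i : ℕ) = 1 then m - 2 else m - 3)
      = (2 * ((e : ℚ) + 1) * (e : ℚ) * ((e : ℚ) - 1) /
            (((N : ℚ) - 2) * ((N : ℚ) - 3) * ((N : ℚ) - 4))) *
          (M.choose 3 : ℚ) * fSYT e (fun _ => m - 3) := by
  obtain ⟨a, rfl⟩ := Nat.exists_eq_add_of_le' hm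
  obtain ⟨k, rfl⟩ := Nat.exists_eq_add_of_le' he
  have hnew := fSYT_two_rows_over_rectangle k a 2 1
  have hrect := fSYT_two_rows_over_rectangle k a 0 0
  simp only [add_zero, ite_self] at hrect
  have hfac : ((2 + 1 + a * (k + 2)).factorial : ℚ) =
      6 * (M.choose 3 : ℚ) * ((0 + a * (k + 2)).factorial : ℚ) := by
    have h := Nat.choose_mul_factorial_mul_factorial (n := M) (k := 3) (by omega)
    have hM' : M = 3 + a * (k + 2) := by simpa using hM
    rw [show M - 3 = 0 + a * (k + 2) by omega] at h
    rw [show 2 + 1 + a * (k + 2) = M by omega, ← h]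
    push_cast [Nat.factorial]
    ring
  have hprod := six_mul_prod_add_four k
  have htop : ((a + 2 + k + 1).factorial : ℚ) =
      ((a : ℚ) + k + 3) * (a + k + 2) * (a + k + 1).factorial := by
    rw [show a + 2 + k + 1 = a + k + 1 + 1 + 1 by ring, Nat.factorial_succ, Nat.factorial_succ]
    push_cast
    ring
  have hsnd : ((a + 1 + k).factorial : ℚ) = ((a : ℚ) + k + 1) * (a + k).factorial := by
    rw [show a + 1 + k = a + k + 1 by ring, Nat.factorial_succ]
    push_cast
    ring
  have hden : (∏ i : Fin k, ((a + k - 1 - (i : ℕ)).factorial : ℚ)) ≠ 0 :=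
    Finset.prod_ne_zero_iff.mpr fun i _ => Nat.cast_ne_zero.mpr (Nat.factorial_ne_zero _)
  have hfst : ((a + k + 1).factorial : ℚ) ≠ 0 := Nat.cast_ne_zero.mpr (Nat.factorial_ne_zero _)
  have hak : ((a + k).factorial : ℚ) ≠ 0 := Nat.cast_ne_zero.mpr (Nat.factorial_ne_zero _)
  have h3 : (N : ℚ) - 2 = a + k + 3 := by rw [hN]; push_cast; ring
  have h2 : (N : ℚ) - 3 = a + k + 2 := by rw [hN]; push_cast; ring
  have h1 : (N : ℚ) - 4 = a + k + 1 := by rw [hN]; push_cast; ring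
  have hp3 : (a : ℚ) + k + 3 ≠ 0 := by positivity
  have hp2 : (a : ℚ) + k + 2 ≠ 0 := by positivity
  have hp1 : (a : ℚ) + k + 1 ≠ 0 := by positivity
  simp only [Nat.add_sub_cancel, show a + 3 - 1 = a + 2 by omega, show a + 3 - 2 = a + 1 by omega]
  rw [hnew, hrect, hfac, htop, hsnd, h1, h2, h3]
  push_cast
  norm_num only [sub_zero, zero_add]
  generalize (∏ i : Fin k, ((a + k - 1 - (i : ℕ)).factorial : ℚ)) = D at hden ⊢
  generalize (∏ i : Fin k, ∏ j ∈ Finset.Ioi i, (((j : ℕ) : ℚ) - ((i : ℕ) : ℚ))) = V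
  generalize (∏ j : Fin k, (((j : ℕ) : ℚ) + 4)) = P at hprod ⊢
  generalize (∏ j : Fin k, (((j : ℕ) : ℚ) + 2)) = Q
  generalize (∏ j : Fin k, (((j : ℕ) : ℚ) + 1)) = R at hprod ⊢
  field_simp
  linear_combination (M.choose 3 : ℚ) * Q * V * hprod
end
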